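/- arXiv:1911.00574 — 2 statements merged into one kernel-verified Lean document; each statement's English description precedes it below -/
import Mathlib

section
/- Let μ and ν be Borel probability measures on ℝⁿ with finite second moments, i.e. ∫|x|² dμ(x) < ∞ and ∫|y|² dν(y) < ∞. Let ψ : ℝⁿ → ℝ be convex and suppose that for every Borel set A ⊂ ℝⁿ one has μ(A) ≤ ν(∂ψ(A)) and ν(A) ≤ μ({x ∈ ℝⁿ : ∂ψ(x) ∩ A ≠ ∅}). Then there exists a Borel probability measure π on ℝⁿ × ℝⁿ with first marginal μ and second marginal ν, concentrated on Graph(∂ψ) = {(x,z) : z ∈ ∂ψ(x)}, and moreover ∫|x−y|² dπ(x,y) ≤ ∫|x−y|² dπ'(x,y) for every Borel probability measure π' on ℝⁿ × ℝⁿ with marginals μ and ν. -/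
open MeasureTheory Set Metric Filter
open scoped RealInnerProductSpace ENNReal

noncomputable section

abbrev E (n : ℕ) := EuclideanSpace ℝ (Fin n)

/-- The subdifferential of `ψ` at `x`:
`∂ψ(x) = {z : ψ(y) ≥ ψ(x) + z·(y−x) for all y}`. -/
def subdiff {n : ℕ} (ψ : E n → ℝ) (x : E n) : Set (E n) :=
  {z | ∀ y : E n, ψ x + ⟪z, y - x⟫ ≤ ψ y}

/-- `∂ψ(A) = ⋃_{x ∈ A} ∂ψ(x)`. -/
def subdiffSet {n : ℕ} (ψ : E n → ℝ) (A : Set (E n)) : Set (E n) :=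
  ⋃ x ∈ A, subdiff ψ x

open scoped BoundedContinuousFunction Topology CompactlySupported

section Strassen

set_option linter.unusedSectionVars false

variable {X : Type*} [NormedAddCommGroup X] [ProperSpace X] [MeasurableSpace X] [BorelSpace X]

lemma aux_pos (μ ν : Measure X) [IsProbabilityMeasure μ] [IsProbabilityMeasure ν]
    (Γ : Set (X × X))
    (hall : ∀ A : Set X, MeasurableSet A → μ A ≤ ν {y | ∃ x ∈ A, (x, y) ∈ Γ})
    (f g : X →ᵇ ℝ) (hfg : ∀ p ∈ Γ, 0 ≤ f p.1 + g p.2) :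
    0 ≤ ∫ x, f x ∂μ + ∫ y, g y ∂ν := by
  set c : ℝ := ‖f‖ + ‖g‖ with hc
  have hf : ∀ x, 0 ≤ c - f x := fun x => by
    have := (abs_le.1 (f.norm_coe_le_norm x)).2
    have := norm_nonneg g
    linarith
  have hg : ∀ x, 0 ≤ c + g x := fun x => by
    have := (abs_le.1 (g.norm_coe_le_norm x)).1
    have := norm_nonneg f
    linarith
  have hfi : Integrable (fun x => c - f x) μ := (integrable_const c).sub (f.integrable μ)
  have hgi : Integrable (fun x => c + g x) ν := (integrable_const c).add (g.integrable ν)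
  have key : ∫⁻ x, ENNReal.ofReal (c - f x) ∂μ ≤ ∫⁻ x, ENNReal.ofReal (c + g x) ∂ν := by
    rw [lintegral_eq_lintegral_meas_lt μ (Eventually.of_forall hf) hfi.aemeasurable,
      lintegral_eq_lintegral_meas_lt ν (Eventually.of_forall hg) hgi.aemeasurable]
    refine lintegral_mono fun t => ?_
    refine (hall _ ?_).trans (measure_mono ?_)
    · exact measurableSet_lt measurable_const (by fun_prop)
    · rintro y ⟨x, hx, hxy⟩
      have := hfg _ hxy
      simp only [mem_ofPred_eq] at hx this ⊢
      linarith
  rw [← ofReal_integral_eq_lintegral_ofReal hfi (Eventually.of_forall hf),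
    ← ofReal_integral_eq_lintegral_ofReal hgi (Eventually.of_forall hg),
    ENNReal.ofReal_le_ofReal_iff (integral_nonneg hg),
    integral_sub (integrable_const c) (f.integrable μ),
    integral_add (integrable_const c) (g.integrable ν)] at key
  simp at key
  linarith

/-- pull back along the first projection -/
def pfst (f : X →ᵇ ℝ) : X × X →ᵇ ℝ := f.compContinuous ⟨Prod.fst, continuous_fst⟩
/-- pull back along the second projection -/
def psnd (f : X →ᵇ ℝ) : X × X →ᵇ ℝ := f.compContinuous ⟨Prod.snd, continuous_snd⟩

@[simp] lemma pfst_apply (f : X →ᵇ ℝ) (p : X × X) : pfst f p = f p.1 := rfl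
@[simp] lemma psnd_apply (f : X →ᵇ ℝ) (p : X × X) : psnd f p = f p.2 := rfl

lemma aux_functional (μ ν : Measure X) [IsProbabilityMeasure μ] [IsProbabilityMeasure ν]
    (Γ : Set (X × X))
    (hall : ∀ A : Set X, MeasurableSet A → μ A ≤ ν {y | ∃ x ∈ A, (x, y) ∈ Γ}) :
    ∃ Λ : (X × X →ᵇ ℝ) →ₗ[ℝ] ℝ, (∀ h : X × X →ᵇ ℝ, (∀ p ∈ Γ, 0 ≤ h p) → 0 ≤ Λ h) ∧
      (∀ f, Λ (pfst f) = ∫ x, f x ∂μ) ∧ (∀ f, Λ (psnd f) = ∫ x, f x ∂ν) := by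
  let S : PointedCone ℝ ((X →ᵇ ℝ) × (X →ᵇ ℝ) × (X × X →ᵇ ℝ)) :=
    { carrier := {v | ∀ p ∈ Γ, 0 ≤ v.1 p.1 + v.2.1 p.2 + v.2.2 p}
      add_mem' := by
        intro a b ha hb p hp
        have := ha p hp
        have := hb p hp
        simp only [Prod.fst_add, Prod.snd_add, BoundedContinuousFunction.coe_add, Pi.add_apply]
        linarith
      zero_mem' := by
        intro p hp
        simp
      smul_mem' := by
        intro c x hx p hp
        have := mul_nonneg c.2 (hx p hp)
        change 0 ≤ (c : ℝ) * x.1 p.1 + (c : ℝ) * x.2.1 p.2 + (c : ℝ) * x.2.2 p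
        linarith }
  let L : ((X →ᵇ ℝ) × (X →ᵇ ℝ) × (X × X →ᵇ ℝ)) →ₗ[ℝ] ℝ :=
    { toFun := fun v => ∫ x, v.1 x ∂μ + ∫ x, v.2.1 x ∂ν
      map_add' := by
        intro a b
        simp only [Prod.fst_add, Prod.snd_add, BoundedContinuousFunction.coe_add, Pi.add_apply]
        rw [integral_add (a.1.integrable μ) (b.1.integrable μ),
          integral_add (a.2.1.integrable ν) (b.2.1.integrable ν)]
        ring
      map_smul' := by
        intro c a
        simp [integral_const_mul, mul_add] }
  let D : Submodule ℝ ((X →ᵇ ℝ) × (X →ᵇ ℝ) × (X × X →ᵇ ℝ)) := Submodule.prod ⊤ (Submodule.prod ⊤ ⊥)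
  let F : ((X →ᵇ ℝ) × (X →ᵇ ℝ) × (X × X →ᵇ ℝ)) →ₗ.[ℝ] ℝ := ⟨D, L.comp D.subtype⟩
  obtain ⟨G, hG, hGS⟩ := riesz_extension S F (by
      rintro ⟨⟨f, g, h⟩, hx⟩ hS
      have h0 : h = 0 := by simpa [F, D] using hx
      subst h0
      refine aux_pos μ ν Γ hall f g fun p hp => ?_
      simpa using hS p hp) (by
      rintro ⟨f, g, h⟩
      refine ⟨⟨(BoundedContinuousFunction.const X (‖f‖ + ‖g‖ + ‖h‖), 0, 0), by simp [F, D]⟩, ?_⟩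
      intro p hp
      have h1 := (abs_le.1 (f.norm_coe_le_norm p.1)).1
      have h2 := (abs_le.1 (g.norm_coe_le_norm p.2)).1
      have h3 := (abs_le.1 (h.norm_coe_le_norm p)).1
      simp
      linarith)
  refine ⟨G.comp ((LinearMap.inr ℝ _ _).comp (LinearMap.inr ℝ _ _)), ?_, ?_, ?_⟩
  · intro h hh
    apply hGS
    intro p hp
    simpa using hh p hp
  · intro f
    have e1 : G (f, 0, 0) = ∫ x, f x ∂μ := by
      have := hG ⟨(f, 0, 0), by simp [F, D]⟩
      simpa [F, L] using this
    have e2 : 0 ≤ G (f, 0, - pfst f) := hGS _ (by intro p hp; simp)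
    have e3 : 0 ≤ G (-f, 0, pfst f) := hGS _ (by intro p hp; simp)
    have e4 : ((f, 0, - pfst f) : ((X →ᵇ ℝ) × (X →ᵇ ℝ) × (X × X →ᵇ ℝ))) = (f, 0, 0) - (0, 0, pfst f) := by simp
    have e5 : ((-f, 0, pfst f) : ((X →ᵇ ℝ) × (X →ᵇ ℝ) × (X × X →ᵇ ℝ))) = (0, 0, pfst f) - (f, 0, 0) := by simp
    rw [e4, map_sub] at e2
    rw [e5, map_sub] at e3
    change G (0, 0, pfst f) = _
    linarith
  · intro f
    have e1 : G (0, f, 0) = ∫ x, f x ∂ν := by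
      have := hG ⟨(0, f, 0), by simp [F, D]⟩
      simpa [F, L] using this
    have e2 : 0 ≤ G (0, f, - psnd f) := hGS _ (by intro p hp; simp)
    have e3 : 0 ≤ G (0, -f, psnd f) := hGS _ (by intro p hp; simp)
    have e4 : ((0, f, - psnd f) : ((X →ᵇ ℝ) × (X →ᵇ ℝ) × (X × X →ᵇ ℝ))) = (0, f, 0) - (0, 0, psnd f) := by simp
    have e5 : ((0, -f, psnd f) : ((X →ᵇ ℝ) × (X →ᵇ ℝ) × (X × X →ᵇ ℝ))) = (0, 0, psnd f) - (0, f, 0) := by simp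
    rw [e4, map_sub] at e2
    rw [e5, map_sub] at e3
    change G (0, 0, psnd f) = _
    linarith

/-- cutoff functions -/
def chi (k : ℕ) : X →ᵇ ℝ :=
  BoundedContinuousFunction.ofNormedAddCommGroup (fun x => max 0 (min 1 ((k : ℝ) + 1 - ‖x‖)))
    (by fun_prop) 1 (fun x => by
      rw [Real.norm_eq_abs, abs_of_nonneg (le_max_left _ _)]
      exact max_le zero_le_one (min_le_left _ _))

lemma chi_apply (k : ℕ) (x : X) : chi k x = max 0 (min 1 ((k : ℝ) + 1 - ‖x‖)) := rfl
lemma chi_nonneg (k : ℕ) (x : X) : 0 ≤ chi k x := le_max_left _ _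
lemma chi_le_one (k : ℕ) (x : X) : chi k x ≤ 1 := max_le zero_le_one (min_le_left _ _)
lemma chi_eq_one (k : ℕ) (x : X) (h : ‖x‖ ≤ k) : chi k x = 1 := by
  rw [chi_apply, min_eq_left (by linarith)]; simp
lemma chi_eq_zero (k : ℕ) (x : X) (h : (k : ℝ) + 1 ≤ ‖x‖) : chi k x = 0 := by
  rw [chi_apply, max_eq_left ((min_le_right _ _).trans (by linarith))]
lemma chi_tendsto (x : X) : Tendsto (fun k : ℕ => chi k x) atTop (𝓝 1) := by
  refine tendsto_const_nhds.congr' ?_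
  filter_upwards [eventually_ge_atTop ⌈‖x‖⌉₊] with k hk
  exact (chi_eq_one k x (Nat.ceil_le.1 hk)).symm

/-- multiplication by a product cutoff -/
def cutm (k : ℕ) (h : X × X →ᵇ ℝ) : X × X →ᵇ ℝ := h * (pfst (chi k) * psnd (chi k))

@[simp] lemma cutm_apply (k : ℕ) (h : X × X →ᵇ ℝ) (p : X × X) :
    cutm k h p = h p * (chi k p.1 * chi k p.2) := rfl

lemma chi_integral (μ : Measure X) [IsProbabilityMeasure μ] :
    Tendsto (fun k : ℕ => ∫ x, chi k x ∂μ) atTop (𝓝 1) := by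
  have := tendsto_integral_of_dominated_convergence (μ := μ) (F := fun k x => chi k x)
    (f := fun _ => (1 : ℝ)) (fun _ => 1) (fun k => (chi k).continuous.measurable.aestronglyMeasurable)
    (integrable_const _) (fun k => Eventually.of_forall fun x => by
      rw [Real.norm_eq_abs, abs_of_nonneg (chi_nonneg k x)]; exact chi_le_one k x)
    (Eventually.of_forall chi_tendsto)
  simpa using this

lemma aux_riesz {Y : Type*} [TopologicalSpace Y] [T2Space Y] [LocallyCompactSpace Y]
    [MeasurableSpace Y] [BorelSpace Y]
    (Λ : (Y →ᵇ ℝ) →ₗ[ℝ] ℝ) (hpos : ∀ h : Y →ᵇ ℝ, (∀ p, 0 ≤ h p) → 0 ≤ Λ h) :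
    ∃ π : Measure Y, π.Regular ∧ ∀ h : Y →ᵇ ℝ, HasCompactSupport (fun p => h p) →
      ∫ p, h p ∂π = Λ h := by
  let L : C_c(Y, ℝ) →ₗ[ℝ] ℝ :=
    { toFun := fun f => Λ f.toBoundedContinuousFunction
      map_add' := fun f g => by rw [← map_add]; rfl
      map_smul' := fun c f => by rw [RingHom.id_apply, ← map_smul]; rfl }
  have hL : ∀ f : C_c(Y, ℝ), 0 ≤ f → 0 ≤ L f := fun f hf => hpos _ fun p => hf p
  refine ⟨RealRMK.rieszMeasure (PositiveLinearMap.mk₀ L hL), inferInstance, fun h hh => ?_⟩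
  let f : C_c(Y, ℝ) := ⟨⟨fun p => h p, h.continuous⟩, hh⟩
  have e := RealRMK.integral_rieszMeasure (PositiveLinearMap.mk₀ L hL) f
  have e2 : (PositiveLinearMap.mk₀ L hL) f = L f := rfl
  have e3 : f.toBoundedContinuousFunction = h := by ext; rfl
  have e4 : L f = Λ f.toBoundedContinuousFunction := rfl
  rw [e2, e4, e3] at e
  exact e

lemma strassen [SecondCountableTopology X]
    (μ ν : Measure X) [IsProbabilityMeasure μ] [IsProbabilityMeasure ν]
    (Γ : Set (X × X)) (hΓ : IsClosed Γ)
    (hall : ∀ A : Set X, MeasurableSet A → μ A ≤ ν {y | ∃ x ∈ A, (x, y) ∈ Γ}) :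
    ∃ π : Measure (X × X), IsProbabilityMeasure π ∧
      π.map Prod.fst = μ ∧ π.map Prod.snd = ν ∧ π Γᶜ = 0 := by
  obtain ⟨Λ, hpos, hΛ1, hΛ2⟩ := aux_functional μ ν Γ hall
  have hmono : ∀ h h' : X × X →ᵇ ℝ, (∀ p, h p ≤ h' p) → Λ h ≤ Λ h' := by
    intro h h' hh
    have := hpos (h' - h) (fun p _ => by simpa using hh p)
    rw [map_sub] at this
    linarith
  have hΛone : Λ 1 = 1 := by
    have := hΛ1 1
    have e : pfst (1 : X →ᵇ ℝ) = 1 := by ext; rfl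
    rw [e] at this
    simpa using this
  obtain ⟨π, hreg, hrep⟩ := aux_riesz Λ fun h hh => hpos h fun p _ => hh p
  -- compactly supported cutoffs
  have hcc : ∀ (k : ℕ) (h : X × X →ᵇ ℝ),
      HasCompactSupport (fun p => (cutm k h) p) := by
    intro k h
    refine HasCompactSupport.of_support_subset_isCompact
      (isCompact_closedBall (0 : X × X) ((k : ℝ) + 1)) ?_
    intro p hp
    rw [mem_closedBall_zero_iff]
    by_contra hlt
    push Not at hlt
    apply hp
    rw [Prod.norm_def] at hlt
    rcases lt_max_iff.1 hlt with h1 | h1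
    · simp [chi_eq_zero k p.1 h1.le]
    · simp [chi_eq_zero k p.2 h1.le]
  have hint : ∀ (k : ℕ) (h : X × X →ᵇ ℝ),
      ∫ p, (cutm k h) p ∂π = Λ (cutm k h) := by
    intro k h
    exact hrep (cutm k h) (hcc k h)
  have hintble : ∀ (k : ℕ) (h : X × X →ᵇ ℝ),
      Integrable (fun p => (cutm k h) p) π := by
    intro k h
    haveI : IsFiniteMeasureOnCompacts π := by
      infer_instance
    have hcnt : Continuous (fun p => (cutm k h) p) := (cutm k h).continuous
    exact Continuous.integrable_of_hasCompactSupport hcnt (hcc k h)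
  have hle : ∀ h : X × X →ᵇ ℝ, (∀ p, 0 ≤ h p) →
      ∫⁻ p, ENNReal.ofReal (h p) ∂π ≤ ENNReal.ofReal (Λ h) := by
    intro h hh
    have hlim : ∀ p, Tendsto (fun k : ℕ =>
        ENNReal.ofReal ((cutm k h) p)) atTop
        (𝓝 (ENNReal.ofReal (h p))) := by
      intro p
      apply ENNReal.tendsto_ofReal
      have := ((chi_tendsto p.1).mul (chi_tendsto p.2)).const_mul (h p)
      simpa using this
    calc ∫⁻ p, ENNReal.ofReal (h p) ∂π
        = ∫⁻ p, liminf (fun k : ℕ =>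
          ENNReal.ofReal ((cutm k h) p)) atTop ∂π :=
          lintegral_congr fun p => (hlim p).liminf_eq.symm
      _ ≤ liminf (fun k : ℕ => ∫⁻ p,
          ENNReal.ofReal ((cutm k h) p) ∂π) atTop :=
          lintegral_liminf_le fun k => by
            exact ENNReal.measurable_ofReal.comp (BoundedContinuousFunction.continuous _).measurable
      _ ≤ ENNReal.ofReal (Λ h) := by
          refine liminf_le_of_le (by isBoundedDefault) fun b hb => ?_
          obtain ⟨k, hk⟩ := hb.exists
          refine hk.trans ?_
          rw [← ofReal_integral_eq_lintegral_ofReal (hintble k h)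
            (Eventually.of_forall fun p => by
              exact mul_nonneg (hh p) (mul_nonneg (chi_nonneg _ _) (chi_nonneg _ _))), hint]
          apply ENNReal.ofReal_le_ofReal
          apply hmono
          intro p
          exact mul_le_of_le_one_right (hh p)
            (mul_le_one₀ (chi_le_one _ _) (chi_nonneg _ _) (chi_le_one _ _))
  have huniv : π univ ≤ 1 := by
    have := hle 1 (fun p => by simp)
    simpa [hΛone] using this
  haveI : IsFiniteMeasure π := ⟨huniv.trans_lt ENNReal.one_lt_top⟩
  have hge : 1 ≤ π.real univ := by
    have hlow : ∀ k : ℕ, ∫ x, chi k x ∂μ + ∫ x, chi k x ∂ν - 1 ≤ π.real univ := by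
      intro k
      have e1 : Λ (pfst (chi k) + psnd (chi k) - 1) ≤ Λ (cutm k 1) := by
        apply hmono
        intro p
        have h1 := chi_le_one k p.1
        have h2 := chi_le_one k p.2
        simp
        nlinarith
      rw [map_sub, map_add, hΛ1, hΛ2, hΛone, ← hint] at e1
      refine e1.trans ?_
      calc _ ≤ ∫ p, (1 : ℝ) ∂π := by
            refine integral_mono (hintble k 1) (integrable_const _) fun p => ?_
            simpa using (mul_le_one₀ (chi_le_one k p.1) (chi_nonneg _ _) (chi_le_one k p.2))
        _ = _ := by simp
    have := ((chi_integral μ).add (chi_integral ν)).sub_const 1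
    have := le_of_tendsto' this hlow
    linarith
  haveI hprob : IsProbabilityMeasure π := by
    refine ⟨le_antisymm huniv ?_⟩
    have := ENNReal.ofReal_le_ofReal hge
    simpa using this
  have hle' : ∀ h : X × X →ᵇ ℝ, ∫ p, h p ∂π ≤ Λ h := by
    intro h
    have hnn : ∀ p, 0 ≤ (h + ‖h‖ • (1 : X × X →ᵇ ℝ)) p := fun p => by
      have := (abs_le.1 (h.norm_coe_le_norm p)).1
      simp
      linarith
    have := hle _ hnn
    rw [← ofReal_integral_eq_lintegral_ofReal (BoundedContinuousFunction.integrable π _)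
      (Eventually.of_forall hnn), ENNReal.ofReal_le_ofReal_iff (hpos _ fun p _ => hnn p), map_add,
      map_smul, hΛone] at this
    simp only [BoundedContinuousFunction.coe_add, Pi.add_apply] at this
    rw [integral_add (h.integrable π) (BoundedContinuousFunction.integrable π _)] at this
    simp at this
    linarith
  have heq : ∀ h : X × X →ᵇ ℝ, ∫ p, h p ∂π = Λ h := by
    intro h
    refine le_antisymm (hle' h) ?_
    have := hle' (-h)
    rw [map_neg] at this
    simp [integral_neg] at this
    linarith
  refine ⟨π, hprob, ?_, ?_, ?_⟩
  · haveI := Measure.isProbabilityMeasure_map (μ := π) measurable_fst.aemeasurable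
    apply ext_of_forall_integral_eq_of_IsFiniteMeasure
    intro f
    rw [integral_map measurable_fst.aemeasurable f.continuous.measurable.aestronglyMeasurable,
      ← hΛ1, ← heq]
    rfl
  · haveI := Measure.isProbabilityMeasure_map (μ := π) measurable_snd.aemeasurable
    apply ext_of_forall_integral_eq_of_IsFiniteMeasure
    intro f
    rw [integral_map measurable_snd.aemeasurable f.continuous.measurable.aestronglyMeasurable,
      ← hΛ2, ← heq]
    rfl
  · have hne : Γ.Nonempty := by
      by_contra hemp
      rw [not_nonempty_iff_eq_empty] at hemp
      have := hpos (-1) (by simp [hemp])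
      rw [map_neg, hΛone] at this
      linarith
    let d : X × X →ᵇ ℝ := BoundedContinuousFunction.ofNormedAddCommGroup
      (fun p => min 1 (infDist p Γ)) (continuous_const.min (continuous_infDist_pt Γ)) 1 (fun p => by
        rw [Real.norm_eq_abs, abs_of_nonneg (le_min zero_le_one infDist_nonneg)]
        exact min_le_left _ _)
    have hd0 : ∀ p ∈ Γ, d p = 0 := fun p hp => by
      change min 1 (infDist p Γ) = 0
      rw [infDist_zero_of_mem hp]; simp
    have hdnn : ∀ p, 0 ≤ d p := fun p => le_min zero_le_one infDist_nonneg
    have e : Λ d ≤ 0 := by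
      have := hpos (-d) fun p hp => by simp [hd0 p hp]
      rw [map_neg] at this
      linarith
    have e2 : ∫ p, d p ∂π = 0 := le_antisymm ((heq d).trans_le e) (integral_nonneg hdnn)
    rw [integral_eq_zero_iff_of_nonneg hdnn (d.integrable π)] at e2
    refine measure_mono_null ?_ (ae_iff.1 e2)
    intro p hp h0
    have hp' := (hΓ.notMem_iff_infDist_pos hne).1 hp
    have : 0 < min 1 (infDist p Γ) := lt_min one_pos hp'
    exact this.ne' h0

end Strassen

lemma isClosed_graph {n : ℕ} (ψ : E n → ℝ) (hψ : Continuous ψ) :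
    IsClosed {p : E n × E n | p.2 ∈ subdiff ψ p.1} := by
  have : {p : E n × E n | p.2 ∈ subdiff ψ p.1} =
      ⋂ y : E n, {p : E n × E n | ψ p.1 + ⟪p.2, y - p.1⟫ ≤ ψ y} := by
    ext p; simp [subdiff]
  rw [this]
  exact isClosed_iInter fun y => isClosed_le (by fun_prop) continuous_const

/-- normalised Legendre transform -/
def leg {n : ℕ} (ψ : E n → ℝ) (x₀ : E n) (y : E n) : ℝ≥0∞ :=
  ⨆ x : E n, ENNReal.ofReal (⟪y, x - x₀⟫ - ψ x + ψ x₀)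

lemma leg_measurable {n : ℕ} (ψ : E n → ℝ) (x₀ : E n) : Measurable (leg ψ x₀) := by
  apply LowerSemicontinuous.measurable
  apply lowerSemicontinuous_iSup
  intro x
  apply Continuous.lowerSemicontinuous
  exact ENNReal.continuous_ofReal.comp (by fun_prop)

lemma leg_eq {n : ℕ} (ψ : E n → ℝ) (x₀ x y : E n) (h : y ∈ subdiff ψ x) :
    leg ψ x₀ y = ENNReal.ofReal (⟪y, x - x₀⟫ - ψ x + ψ x₀) := by
  apply le_antisymm
  · refine iSup_le fun x' => ENNReal.ofReal_le_ofReal ?_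
    have := h x'
    simp only [inner_sub_right] at this ⊢
    linarith
  · exact le_iSup (fun x : E n => ENNReal.ofReal (⟪y, x - x₀⟫ - ψ x + ψ x₀)) x

/-- the pointwise quantity compensating the cost -/
lemma key_id {n : ℕ} (x y x₀ z₀ : E n) :
    ‖x - y‖ ^ 2 + (2 * (⟪y, x - x₀⟫ - ⟪z₀, x - x₀⟫) + (‖x + z₀‖ ^ 2 + ‖y + x₀‖ ^ 2)) =
      2 * ‖x‖ ^ 2 + 2 * ‖y‖ ^ 2 + ‖x₀ + z₀‖ ^ 2 := by
  rw [norm_sub_sq_real, norm_add_sq_real, norm_add_sq_real, norm_add_sq_real]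
  simp only [inner_sub_right]
  rw [real_inner_comm y x, real_inner_comm z₀ x, real_inner_comm x₀ y, real_inner_comm z₀ x₀]
  ring

/-- if ψ is convex, μ and ν are probability measures with finite second
moments satisfying both one-sided transport inequalities, then there is a coupling of
μ and ν concentrated on the graph of ∂ψ, and this coupling is optimal for the
quadratic cost. -/
theorem stmt1 (n : ℕ) (μ ν : Measure (E n))
    (hμp : IsProbabilityMeasure μ) (hνp : IsProbabilityMeasure ν)
    (hμ2 : Integrable (fun x : E n => ‖x‖ ^ 2) μ)
    (hν2 : Integrable (fun y : E n => ‖y‖ ^ 2) ν)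
    (ψ : E n → ℝ) (hψ : ConvexOn ℝ Set.univ ψ)
    (h1 : ∀ A : Set (E n), MeasurableSet A → μ A ≤ ν (subdiffSet ψ A))
    (h2 : ∀ A : Set (E n), MeasurableSet A →
      ν A ≤ μ {x : E n | (subdiff ψ x ∩ A).Nonempty}) :
    ∃ π : Measure (E n × E n), IsProbabilityMeasure π ∧
      π.map Prod.fst = μ ∧ π.map Prod.snd = ν ∧
      π {p : E n × E n | p.2 ∉ subdiff ψ p.1} = 0 ∧
      ∀ π' : Measure (E n × E n), IsProbabilityMeasure π' →
        π'.map Prod.fst = μ → π'.map Prod.snd = ν →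
        ∫⁻ p, ENNReal.ofReal (‖p.1 - p.2‖ ^ 2) ∂π ≤
          ∫⁻ p, ENNReal.ofReal (‖p.1 - p.2‖ ^ 2) ∂π' := by
  have hcont : Continuous ψ := hψ.locallyLipschitz.continuous
  obtain ⟨π, hπ, hπ1, hπ2, hπ0⟩ := strassen μ ν {p : E n × E n | p.2 ∈ subdiff ψ p.1}
    (isClosed_graph ψ hcont) (fun A hA => by
      refine (h1 A hA).trans (measure_mono ?_)
      intro y hy
      simpa [subdiffSet] using hy)
  have hπ0' : π {p : E n × E n | p.2 ∉ subdiff ψ p.1} = 0 := hπ0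
  refine ⟨π, hπ, hπ1, hπ2, hπ0', ?_⟩
  intro π' hπ' hπ1' hπ2'
  have hae : ∀ᵐ p ∂π, p.2 ∈ subdiff ψ p.1 := ae_iff.2 hπ0'
  obtain ⟨⟨x₀, z₀⟩, h0⟩ := hae.exists
  simp only at h0
  let a : E n → ℝ≥0∞ := fun x => ENNReal.ofReal (ψ x - ψ x₀ - ⟪z₀, x - x₀⟫)
  have ha : Measurable a := ENNReal.measurable_ofReal.comp
    (Continuous.measurable (by fun_prop))
  let φ := leg ψ x₀
  have hφ : Measurable φ := leg_measurable ψ x₀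
  let A : E n → ℝ≥0∞ := fun x => 2 * a x + ENNReal.ofReal (‖x + z₀‖ ^ 2)
  let B : E n → ℝ≥0∞ := fun y => 2 * φ y + ENNReal.ofReal (‖y + x₀‖ ^ 2)
  have hA : Measurable A := (ha.const_mul 2).add
    (ENNReal.measurable_ofReal.comp (Continuous.measurable (by fun_prop)))
  have hB : Measurable B := (hφ.const_mul 2).add
    (ENNReal.measurable_ofReal.comp (Continuous.measurable (by fun_prop)))
  let M : E n × E n → ℝ≥0∞ := fun p =>
    ENNReal.ofReal (2 * ‖p.1‖ ^ 2) + ENNReal.ofReal (2 * ‖p.2‖ ^ 2 + ‖x₀ + z₀‖ ^ 2)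
  have hM : ∀ p, M p = ENNReal.ofReal (2 * ‖p.1‖ ^ 2 + 2 * ‖p.2‖ ^ 2 + ‖x₀ + z₀‖ ^ 2) := by
    intro p
    change _ + _ = _
    rw [← ENNReal.ofReal_add (by positivity) (by positivity), add_assoc]
  have hc : Measurable fun p : E n × E n => ENNReal.ofReal (‖p.1 - p.2‖ ^ 2) :=
    ENNReal.measurable_ofReal.comp (Continuous.measurable (by fun_prop))
  have hge : ∀ p : E n × E n, M p ≤ ENNReal.ofReal (‖p.1 - p.2‖ ^ 2) + (A p.1 + B p.2) := by
    rintro ⟨x, y⟩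
    rw [hM, ← key_id x y x₀ z₀]
    have hφ1 : ENNReal.ofReal (⟪y, x - x₀⟫ - ψ x + ψ x₀) ≤ φ y :=
      le_iSup (fun x : E n => ENNReal.ofReal (⟪y, x - x₀⟫ - ψ x + ψ x₀)) x
    have hs : ENNReal.ofReal (⟪y, x - x₀⟫ - ⟪z₀, x - x₀⟫) ≤ a x + φ y := by
      refine le_trans ?_ (add_le_add_right hφ1 (a x))
      refine le_trans ?_ ENNReal.ofReal_add_le
      apply ENNReal.ofReal_le_ofReal
      linarith
    refine ENNReal.ofReal_add_le.trans (add_le_add_right ?_ _)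
    refine ENNReal.ofReal_add_le.trans ?_
    rw [ENNReal.ofReal_mul two_pos.le, ENNReal.ofReal_add (by positivity) (by positivity)]
    calc _ ≤ 2 * (a x + φ y) + (ENNReal.ofReal (‖x + z₀‖ ^ 2) + ENNReal.ofReal (‖y + x₀‖ ^ 2)) := by
          gcongr
          simp
      _ = A x + B y := by simp only [A, B]; ring
  have heq : ∀ p : E n × E n, p.2 ∈ subdiff ψ p.1 →
      ENNReal.ofReal (‖p.1 - p.2‖ ^ 2) + (A p.1 + B p.2) = M p := by
    rintro ⟨x, y⟩ hp
    simp only at hp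
    rw [hM, ← key_id x y x₀ z₀]
    have n1 : 0 ≤ ψ x - ψ x₀ - ⟪z₀, x - x₀⟫ := by have := h0 x; linarith
    have n2 : 0 ≤ ⟪y, x - x₀⟫ - ψ x + ψ x₀ := by
      have := hp x₀
      simp only [inner_sub_right] at this ⊢
      linarith
    have hs : ENNReal.ofReal (⟪y, x - x₀⟫ - ⟪z₀, x - x₀⟫) = a x + φ y := by
      simp only [a, φ]
      rw [leg_eq ψ x₀ x y hp, ← ENNReal.ofReal_add n1 n2]
      congr 1; ring
    have n3 : 0 ≤ ⟪y, x - x₀⟫ - ⟪z₀, x - x₀⟫ := by linarith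
    rw [ENNReal.ofReal_add (by positivity) (by positivity),
      ENNReal.ofReal_add (by positivity) (by positivity), ENNReal.ofReal_mul two_pos.le, hs,
      ENNReal.ofReal_add (by positivity) (by positivity)]
    simp only [A, B, ENNReal.ofReal_ofNat]
    ring
  have hI : ∀ (F G : E n → ℝ≥0∞), Measurable F → Measurable G → ∀ ρ : Measure (E n × E n),
      ρ.map Prod.fst = μ → ρ.map Prod.snd = ν →
      ∫⁻ p, (F p.1 + G p.2) ∂ρ = ∫⁻ x, F x ∂μ + ∫⁻ y, G y ∂ν := by
    intro F G hF hG ρ r1 r2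
    have hF' : Measurable fun p : E n × E n => F p.1 := hF.comp measurable_fst
    rw [lintegral_add_left hF', ← r1, ← r2, lintegral_map hF measurable_fst,
      lintegral_map hG measurable_snd]
  have m1 : Measurable fun x : E n => ENNReal.ofReal (2 * ‖x‖ ^ 2) :=
    ENNReal.measurable_ofReal.comp (Continuous.measurable (by fun_prop))
  have m2 : Measurable fun y : E n => ENNReal.ofReal (2 * ‖y‖ ^ 2 + ‖x₀ + z₀‖ ^ 2) :=
    ENNReal.measurable_ofReal.comp (Continuous.measurable (by fun_prop))
  set S := ∫⁻ x, A x ∂μ + ∫⁻ y, B y ∂ν with hS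
  have hπeq : ∫⁻ p, ENNReal.ofReal (‖p.1 - p.2‖ ^ 2) ∂π + S = ∫⁻ p, M p ∂π := by
    rw [hS, ← hI A B hA hB π hπ1 hπ2, ← lintegral_add_left hc]
    refine lintegral_congr_ae ?_
    filter_upwards [hae] with p hp using heq p hp
  have hMM : ∫⁻ p, M p ∂π = ∫⁻ p, M p ∂π' := by
    rw [hI _ _ m1 m2 π hπ1 hπ2, hI _ _ m1 m2 π' hπ1' hπ2']
  have hMfin : ∫⁻ p, M p ∂π ≠ ∞ := by
    rw [hI _ _ m1 m2 π hπ1 hπ2]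
    have f1 := (hμ2.const_mul 2).lintegral_lt_top
    have f2 := ((hν2.const_mul 2).add (integrable_const (‖x₀ + z₀‖ ^ 2))).lintegral_lt_top
    exact (ENNReal.add_lt_top.2 ⟨f1, f2⟩).ne
  have hSfin : S ≠ ∞ := fun h => by
    rw [← hπeq, h] at hMfin
    simp at hMfin
  have hfinal : ∫⁻ p, ENNReal.ofReal (‖p.1 - p.2‖ ^ 2) ∂π + S ≤
      ∫⁻ p, ENNReal.ofReal (‖p.1 - p.2‖ ^ 2) ∂π' + S := by
    rw [hπeq, hMM, hS, ← hI A B hA hB π' hπ1' hπ2', ← lintegral_add_left hc]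
    exact lintegral_mono hge
  exact (ENNReal.add_le_add_iff_right hSfin).1 hfinal
end
end

section
/- Let Ω ⊂ ℝ² be open, let ψ : Ω → ℝ be a C² convex function with ψ ≥ 0 on Ω and det D²ψ(x) ≥ 1/λ² for all x ∈ Ω (λ > 0), and suppose ψ(x₀) = 0 for some x₀ ∈ Ω with δ := dist(x₀, ∂Ω) > 0. Let L := sup_{x ∈ Ω} |∇ψ(x)| and assume 0 < L < ∞. Let e be a unit vector and H := {x₀ + t e : t ∈ ℝ} the line through x₀ with direction e. Then for every ℓ with 0 < ℓ ≤ δ/2, the quantity γ := ( sup_{x ∈ B_ℓ(x₀) ∩ H} ψ(x) ) / L satisfies γ > 0 and ℓ² · ln(1 + δ/γ) ≤ 8 λ² L². -/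
open MeasureTheory Set Metric Filter
open scoped RealInnerProductSpace ENNReal

noncomputable section

/-- The determinant of the Hessian matrix `D²ψ(x)`. -/
def hessDet {n : ℕ} (ψ : E n → ℝ) (x : E n) : ℝ :=
  Matrix.det (Matrix.of fun i j : Fin n =>
    iteratedFDeriv ℝ 2 ψ x ![EuclideanSpace.single i 1, EuclideanSpace.single j 1])

lemma slope_core (u p a : ℝ → ℝ) (ℓ M : ℝ) (hℓ : 0 < ℓ)
    (hu : ∀ x ∈ Icc (-ℓ) ℓ, HasDerivAt u (p x) x)
    (hp : ∀ x ∈ Icc (-ℓ) ℓ, HasDerivAt p (a x) x)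
    (ha : ∀ x ∈ Icc (-ℓ) ℓ, 0 < a x)
    (hu0 : ∀ x ∈ Icc (-ℓ) ℓ, 0 ≤ u x)
    (hu1 : ∀ x ∈ Icc (-ℓ) ℓ, u x ≤ M) :
    0 < p (ℓ/2) - p (-(ℓ/2)) ∧ p (ℓ/2) - p (-(ℓ/2)) ≤ 4 / ℓ * M := by
  have hmono : StrictMonoOn p (Icc (-ℓ) ℓ) := by
    apply strictMonoOn_of_deriv_pos (convex_Icc _ _)
    · exact fun x hx => (hp x hx).continuousAt.continuousWithinAt
    · intro x hx
      rw [interior_Icc] at hx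
      rw [(hp x (Ioo_subset_Icc_self hx)).deriv]
      exact ha x (Ioo_subset_Icc_self hx)
  have mvt : ∀ s t : ℝ, -ℓ ≤ s → s < t → t ≤ ℓ → ∃ c ∈ Ioo s t, p c = (u t - u s) / (t - s) := by
    intro s t hs hst ht
    apply exists_hasDerivAt_eq_slope u p hst
    · exact fun x hx => (hu x ⟨hs.trans hx.1, hx.2.trans ht⟩).continuousAt.continuousWithinAt
    · exact fun x hx => hu x ⟨hs.trans hx.1.le, hx.2.le.trans ht⟩
  obtain ⟨c, hc, hc'⟩ := mvt (ℓ/2) ℓ (by linarith) (by linarith) le_rfl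
  obtain ⟨d, hd, hd'⟩ := mvt (-ℓ) (-(ℓ/2)) le_rfl (by linarith) (by linarith)
  have h1 : p (ℓ/2) ≤ p c := (hmono ⟨by linarith, by linarith⟩ ⟨by linarith [hc.1], hc.2.le⟩ hc.1).le
  have h2 : p d ≤ p (-(ℓ/2)) := (hmono ⟨hd.1.le, by linarith [hd.2]⟩ ⟨by linarith, by linarith⟩ hd.2).le
  refine ⟨sub_pos.2 (hmono ⟨by linarith, by linarith⟩ ⟨by linarith, by linarith⟩ (by linarith)), ?_⟩
  have e1 : p c * ℓ ≤ 2 * M := by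
    rw [hc', show ℓ - ℓ/2 = ℓ/2 by ring]
    field_simp
    linarith [hu0 (ℓ/2) ⟨by linarith, by linarith⟩, hu1 ℓ ⟨by linarith, by linarith⟩]
  have e2 : - (2 * M) ≤ p d * ℓ := by
    rw [hd', show -(ℓ/2) - -ℓ = ℓ/2 by ring]
    field_simp
    linarith [hu0 (-(ℓ/2)) ⟨by linarith, by linarith⟩, hu1 (-ℓ) ⟨by linarith, by linarith⟩]
  rw [div_mul_eq_mul_div, le_div_iff₀ hℓ]
  nlinarith

lemma half_core (u p q a b : ℝ → ℝ → ℝ) (ℓ Y γ L lam : ℝ) (hℓ : 0 < ℓ) (hY : 0 < Y)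
    (hγ : 0 < γ) (hL : 0 < L) (hlam : 0 < lam)
    (hu : ∀ x ∈ Icc (-ℓ) ℓ, ∀ y ∈ Icc 0 Y, HasDerivAt (fun s => u s y) (p x y) x)
    (hp : ∀ x ∈ Icc (-ℓ) ℓ, ∀ y ∈ Icc 0 Y, HasDerivAt (fun s => p s y) (a x y) x)
    (hq : ∀ x ∈ Icc (-ℓ) ℓ, ∀ y ∈ Icc 0 Y, HasDerivAt (fun s => q x s) (b x y) y)
    (hac : ContinuousOn (Function.uncurry a) (Icc (-ℓ) ℓ ×ˢ Icc 0 Y))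
    (hbc : ContinuousOn (Function.uncurry b) (Icc (-ℓ) ℓ ×ˢ Icc 0 Y))
    (ha : ∀ x ∈ Icc (-ℓ) ℓ, ∀ y ∈ Icc 0 Y, 0 < a x y)
    (hab : ∀ x ∈ Icc (-ℓ) ℓ, ∀ y ∈ Icc 0 Y, 1 / lam ^ 2 ≤ a x y * b x y)
    (hu0 : ∀ x ∈ Icc (-ℓ) ℓ, ∀ y ∈ Icc 0 Y, 0 ≤ u x y)
    (hu1 : ∀ x ∈ Icc (-ℓ) ℓ, ∀ y ∈ Icc 0 Y, u x y ≤ L * (γ + y)) :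
    ℓ ^ 3 / (4 * lam ^ 2 * L) * Real.log (1 + Y / γ) ≤
      ∫ x in (-(ℓ/2))..(ℓ/2), (q x Y - q x 0) := by
  have hsub : Icc (-(ℓ/2)) (ℓ/2) ⊆ Icc (-ℓ) ℓ := Icc_subset_Icc (by linarith) (by linarith)
  have hle : -(ℓ/2) ≤ ℓ/2 := by linarith
  -- sections
  have hax : ∀ y ∈ Icc 0 Y, ContinuousOn (fun x => a x y) (Icc (-(ℓ/2)) (ℓ/2)) := fun y hy =>
    hac.comp (f := fun x => (x, y)) (by fun_prop) (fun x hx => ⟨hsub hx, hy⟩)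
  have hbx : ∀ y ∈ Icc 0 Y, ContinuousOn (fun x => b x y) (Icc (-(ℓ/2)) (ℓ/2)) := fun y hy =>
    hbc.comp (f := fun x => (x, y)) (by fun_prop) (fun x hx => ⟨hsub hx, hy⟩)
  have hby : ∀ x ∈ Icc (-(ℓ/2)) (ℓ/2), ContinuousOn (fun y => b x y) (Icc 0 Y) := fun x hx =>
    hbc.comp (f := fun y => (x, y)) (by fun_prop) (fun y hy => ⟨hsub hx, hy⟩)
  have hIntg : IntegrableOn (Function.uncurry b) (uIcc (-(ℓ/2)) (ℓ/2) ×ˢ uIcc 0 Y) := by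
    rw [uIcc_of_le hle, uIcc_of_le hY.le]
    exact (hbc.mono (prod_mono hsub subset_rfl)).integrableOn_compact
      (isCompact_Icc.prod isCompact_Icc)
  have hIntg' : Integrable (Function.uncurry b)
      ((volume.restrict (uIoc (-(ℓ/2)) (ℓ/2))).prod (volume.restrict (uIoc 0 Y))) := by
    rw [Measure.prod_restrict]
    exact hIntg.mono_set (prod_mono uIoc_subset_uIcc uIoc_subset_uIcc)
  have hL1 : ∫ x in (-(ℓ/2))..(ℓ/2), (q x Y - q x 0)
      = ∫ x in (-(ℓ/2))..(ℓ/2), ∫ y in (0:ℝ)..Y, b x y := by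
    apply intervalIntegral.integral_congr
    intro x hx
    rw [uIcc_of_le hle] at hx
    refine (intervalIntegral.integral_eq_sub_of_hasDerivAt (f := fun s => q x s) ?_ ?_).symm
    · intro y hy
      rw [uIcc_of_le hY.le] at hy
      exact hq x (hsub hx) y hy
    · exact (hby x hx).intervalIntegrable_of_Icc hY.le
  have hL2 : ∫ x in (-(ℓ/2))..(ℓ/2), ∫ y in (0:ℝ)..Y, b x y
      = ∫ y in (0:ℝ)..Y, ∫ x in (-(ℓ/2))..(ℓ/2), b x y := by
    simp only [intervalIntegral.integral_of_le hle, intervalIntegral.integral_of_le hY.le]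
    rw [uIoc_of_le hle, uIoc_of_le hY.le] at hIntg'
    exact integral_integral_swap hIntg'
  have hgint : IntervalIntegrable (fun y => ∫ x in (-(ℓ/2))..(ℓ/2), b x y) volume 0 Y := by
    rw [intervalIntegrable_iff]
    rw [uIoc_of_le hle] at hIntg'
    simp only [intervalIntegral.integral_of_le hle]
    exact hIntg'.integral_prod_right
  have hbd : ∀ y ∈ Icc 0 Y, ℓ ^ 3 / (4 * lam ^ 2 * L) * (1 / (γ + y)) ≤
      ∫ x in (-(ℓ/2))..(ℓ/2), b x y := by
    intro y hy
    have hgy : 0 < γ + y := by linarith [hy.1]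
    obtain ⟨-, h2⟩ := slope_core (fun s => u s y) (fun s => p s y) (fun s => a s y) ℓ
      (L * (γ + y)) hℓ (fun x hx => hu x hx y hy) (fun x hx => hp x hx y hy)
      (fun x hx => ha x hx y hy) (fun x hx => hu0 x hx y hy) (fun x hx => hu1 x hx y hy)
    have hA : ∫ x in (-(ℓ/2))..(ℓ/2), a x y = p (ℓ/2) y - p (-(ℓ/2)) y := by
      refine intervalIntegral.integral_eq_sub_of_hasDerivAt (f := fun s => p s y) ?_ ?_
      · intro x hx
        rw [uIcc_of_le hle] at hx
        exact hp x (hsub hx) y hy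
      · exact (hax y hy).intervalIntegrable_of_Icc hle
    set t : ℝ := ℓ ^ 2 / (4 * lam * (L * (γ + y))) with ht
    have hpt : ∀ x ∈ Icc (-(ℓ/2)) (ℓ/2), 2 * t / lam - t ^ 2 * a x y ≤ b x y := by
      intro x hx
      have h3 := ha x (hsub hx) y hy
      have h4 := hab x (hsub hx) y hy
      have h5 : 0 ≤ a x y * (b x y - (2 * t / lam - t ^ 2 * a x y)) := by
        have : a x y * (b x y - (2 * t / lam - t ^ 2 * a x y)) =
          (a x y * b x y - 1 / lam ^ 2) + (t * a x y - 1 / lam) ^ 2 := by ring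
        rw [this]
        have := sq_nonneg (t * a x y - 1 / lam)
        linarith
      linarith [nonneg_of_mul_nonneg_right h5 h3]
    have hai := (hax y hy).intervalIntegrable_of_Icc (μ := volume) hle
    have h6 : ∫ x in (-(ℓ/2))..(ℓ/2), (2 * t / lam - t ^ 2 * a x y) ≤
        ∫ x in (-(ℓ/2))..(ℓ/2), b x y := by
      apply intervalIntegral.integral_mono_on hle _ _ hpt
      · exact intervalIntegrable_const.sub (hai.const_mul _)
      · exact (hbx y hy).intervalIntegrable_of_Icc hle
    rw [intervalIntegral.integral_sub intervalIntegrable_const (hai.const_mul _),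
      intervalIntegral.integral_const_mul, hA, intervalIntegral.integral_const] at h6
    refine le_trans ?_ h6
    have h7 : t ^ 2 * (p (ℓ/2) y - p (-(ℓ/2)) y) ≤ t ^ 2 * (4 / ℓ * (L * (γ + y))) :=
      mul_le_mul_of_nonneg_left h2 (sq_nonneg t)
    have h8 : ℓ ^ 3 / (4 * lam ^ 2 * L) * (1 / (γ + y)) =
      (ℓ/2 - -(ℓ/2)) • (2 * t / lam) - t ^ 2 * (4 / ℓ * (L * (γ + y))) := by
      rw [ht, smul_eq_mul]
      field_simp
      ring
    linarith
  have hlog : ∫ y in (0:ℝ)..Y, ℓ ^ 3 / (4 * lam ^ 2 * L) * (1 / (γ + y)) =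
      ℓ ^ 3 / (4 * lam ^ 2 * L) * Real.log (1 + Y / γ) := by
    rw [intervalIntegral.integral_const_mul]
    congr 1
    rw [intervalIntegral.integral_comp_add_left (fun z => 1 / z) γ,
      integral_one_div_of_pos (by linarith) (by linarith)]
    congr 1
    field_simp
    ring
  rw [hL1, hL2, ← hlog]
  apply intervalIntegral.integral_mono_on hY.le _ hgint hbd
  apply ContinuousOn.intervalIntegrable_of_Icc hY.le
  apply continuousOn_const.mul
  apply ContinuousOn.div continuousOn_const (by fun_prop)
  intro y hy
  have := hy.1
  positivity

lemma hasDerivAt_line (Ω : Set (E 2)) (hΩ : IsOpen Ω) (ψ : E 2 → ℝ)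
    (hC2 : ContDiffOn ℝ 2 ψ Ω) (c v : E 2) (x : ℝ) (h : c + x • v ∈ Ω) :
    HasDerivAt (fun s : ℝ => ψ (c + s • v)) (fderiv ℝ ψ (c + x • v) v) x := by
  have h1 : HasDerivAt (fun s : ℝ => c + s • v) v x := by
    simpa using ((hasDerivAt_id x).smul_const v).const_add c
  have h2 : DifferentiableAt ℝ ψ (c + x • v) :=
    (hC2.contDiffAt (hΩ.mem_nhds h)).differentiableAt (by norm_num)
  exact h2.hasFDerivAt.comp_hasDerivAt x h1

lemma contDiffOn_fderiv' (Ω : Set (E 2)) (hΩ : IsOpen Ω) (ψ : E 2 → ℝ)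
    (hC2 : ContDiffOn ℝ 2 ψ Ω) : ContDiffOn ℝ 1 (fderiv ℝ ψ) Ω :=
  hC2.fderiv_of_isOpen hΩ (by norm_num)

lemma hasDerivAt_line2 (Ω : Set (E 2)) (hΩ : IsOpen Ω) (ψ : E 2 → ℝ)
    (hC2 : ContDiffOn ℝ 2 ψ Ω) (c v w : E 2) (x : ℝ) (h : c + x • v ∈ Ω) :
    HasDerivAt (fun s : ℝ => fderiv ℝ ψ (c + s • v) w)
      (fderiv ℝ (fderiv ℝ ψ) (c + x • v) v w) x := by
  have h1 : HasDerivAt (fun s : ℝ => c + s • v) v x := by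
    simpa using ((hasDerivAt_id x).smul_const v).const_add c
  have h2 : DifferentiableAt ℝ (fderiv ℝ ψ) (c + x • v) :=
    ((contDiffOn_fderiv' Ω hΩ ψ hC2).contDiffAt (hΩ.mem_nhds h)).differentiableAt (by norm_num)
  have h3 := h2.hasFDerivAt.comp_hasDerivAt x h1
  simpa using h3.clm_apply (hasDerivAt_const x w)

lemma hess_cont (Ω : Set (E 2)) (hΩ : IsOpen Ω) (ψ : E 2 → ℝ)
    (hC2 : ContDiffOn ℝ 2 ψ Ω) (v w : E 2) :
    ContinuousOn (fun p => fderiv ℝ (fderiv ℝ ψ) p v w) Ω := by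
  have h := (contDiffOn_fderiv' Ω hΩ ψ hC2).continuousOn_fderiv_of_isOpen hΩ le_rfl
  exact (h.clm_apply continuousOn_const).clm_apply continuousOn_const

lemma hess_nonneg (Ω : Set (E 2)) (hΩ : IsOpen Ω) (ψ : E 2 → ℝ)
    (hC2 : ContDiffOn ℝ 2 ψ Ω) (hconv : ConvexOn ℝ Ω ψ) (c v : E 2) (hc : c ∈ Ω) :
    0 ≤ fderiv ℝ (fderiv ℝ ψ) c v v := by
  have hcont : Continuous (fun s : ℝ => c + s • v) := by fun_prop
  set S : Set ℝ := (fun s : ℝ => c + s • v) ⁻¹' Ω with hS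
  have hSo : IsOpen S := hΩ.preimage hcont
  have h0 : (0:ℝ) ∈ S := by simpa [hS] using hc
  have hcS : ConvexOn ℝ S (fun s : ℝ => ψ (c + s • v)) := by
    have := hconv.comp_affineMap (AffineMap.lineMap c (c + v) : ℝ →ᵃ[ℝ] E 2)
    have he : ∀ s : ℝ, (AffineMap.lineMap c (c + v) : ℝ →ᵃ[ℝ] E 2) s = c + s • v := by
      intro s; simp [AffineMap.lineMap_apply, add_comm]
    have e1 : ((AffineMap.lineMap c (c + v) : ℝ →ᵃ[ℝ] E 2) : ℝ → E 2) = fun s => c + s • v :=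
      funext he
    rw [e1] at this
    exact this
  have hd : ∀ s ∈ S, HasDerivAt (fun s : ℝ => ψ (c + s • v)) (fderiv ℝ ψ (c + s • v) v) s :=
    fun s hs => hasDerivAt_line Ω hΩ ψ hC2 c v s hs
  have hm : MonotoneOn (fun s : ℝ => fderiv ℝ ψ (c + s • v) v) S := by
    have := hcS.monotoneOn_deriv (fun s hs => (hd s hs).differentiableAt)
    exact this.congr (fun s hs => (hd s hs).deriv)
  have h2 := hasDerivAt_line2 Ω hΩ ψ hC2 c v v 0 (by simpa using hc)
  have h3 := hm.derivWithin_nonneg (x := 0)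
  rw [derivWithin_of_isOpen hSo h0, h2.deriv] at h3
  simpa using h3

lemma hess_prod (Ω : Set (E 2)) (hΩ : IsOpen Ω) (ψ : E 2 → ℝ)
    (hC2 : ContDiffOn ℝ 2 ψ Ω) (e f : E 2) (he : ‖e‖ = 1) (s : ℝ) (hs : s ^ 2 = 1)
    (hf0 : f 0 = - s * e 1) (hf1 : f 1 = s * e 0) (c : E 2) (hc : c ∈ Ω) :
    hessDet ψ c ≤ fderiv ℝ (fderiv ℝ ψ) c e e * fderiv ℝ (fderiv ℝ ψ) c f f := by
  have hn : e 0 ^ 2 + e 1 ^ 2 = 1 := by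
    have := EuclideanSpace.real_norm_sq_eq e
    rw [he, Fin.sum_univ_two] at this
    linarith
  have dec : ∀ z : E 2, z = z 0 • EuclideanSpace.single 0 (1:ℝ) + z 1 • EuclideanSpace.single 1 (1:ℝ) := by
    intro z
    ext i
    fin_cases i <;> simp
  have hsym : IsSymmSndFDerivAt ℝ ψ c :=
    (hC2.contDiffAt (hΩ.mem_nhds hc)).isSymmSndFDerivAt (by simp)
  have h01 := hsym.eq (EuclideanSpace.single 0 (1:ℝ)) (EuclideanSpace.single 1 (1:ℝ))
  unfold hessDet
  rw [Matrix.det_fin_two]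
  simp only [Matrix.of_apply, iteratedFDeriv_two_apply, Matrix.cons_val_zero, Matrix.cons_val_one]
  set H := fderiv ℝ (fderiv ℝ ψ) c
  have expand : ∀ z w : E 2, H z w =
      z 0 * w 0 * H (EuclideanSpace.single 0 (1:ℝ)) (EuclideanSpace.single 0 (1:ℝ))
      + (z 0 * w 1 + z 1 * w 0) * H (EuclideanSpace.single 0 (1:ℝ)) (EuclideanSpace.single 1 (1:ℝ))
      + z 1 * w 1 * H (EuclideanSpace.single 1 (1:ℝ)) (EuclideanSpace.single 1 (1:ℝ)) := by
    intro z w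
    conv_lhs => rw [dec z, dec w]
    simp only [map_add, map_smul, add_apply, smul_apply,
      smul_eq_mul, ← h01]
    ring
  rw [expand e e, expand f f, hf0, hf1, ← h01]
  generalize H (EuclideanSpace.single 0 (1:ℝ)) (EuclideanSpace.single 0 (1:ℝ)) = A
  generalize H (EuclideanSpace.single 0 (1:ℝ)) (EuclideanSpace.single 1 (1:ℝ)) = B
  generalize H (EuclideanSpace.single 1 (1:ℝ)) (EuclideanSpace.single 1 (1:ℝ)) = C
  generalize e 0 = x at *
  generalize e 1 = y at *
  have key : (x * x * A + (x * y + y * x) * B + y * y * C) *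
      (-s * y * (-s * y) * A + (-s * y * (s * x) + s * x * (-s * y)) * B + s * x * (s * x) * C) =
      s ^ 2 * ((x ^ 2 + y ^ 2) ^ 2 * (A * C - B * B) + (x * y * (C - A) + (x ^ 2 - y ^ 2) * B) ^ 2) := by
    ring
  rw [key, hs, hn]
  nlinarith [sq_nonneg (x * y * (C - A) + (x ^ 2 - y ^ 2) * B)]

lemma hess_pos (Ω : Set (E 2)) (hΩ : IsOpen Ω) (ψ : E 2 → ℝ)
    (hC2 : ContDiffOn ℝ 2 ψ Ω) (hconv : ConvexOn ℝ Ω ψ) (lam : ℝ) (hlam : 0 < lam)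
    (hdet : ∀ x ∈ Ω, 1 / lam ^ 2 ≤ hessDet ψ x) (e : E 2) (he : ‖e‖ = 1)
    (c : E 2) (hc : c ∈ Ω) : 0 < fderiv ℝ (fderiv ℝ ψ) c e e := by
  have h := hess_prod Ω hΩ ψ hC2 e !₂[- e 1, e 0] he 1 (by norm_num) (by simp) (by simp) c hc
  have h1 := hdet c hc
  have h2 : 0 < 1 / lam ^ 2 := by positivity
  rcases (hess_nonneg Ω hΩ ψ hC2 hconv c e hc).lt_or_eq with h3 | h3
  · exact h3
  · rw [← h3, zero_mul] at h
    linarith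

lemma mem_rect (x₀ e f : E 2) (δ ℓ : ℝ) (hδ : 0 < δ) (hℓ : ℓ ≤ δ / 2)
    (he : ‖e‖ = 1) (s : ℝ) (hs : s ^ 2 = 1)
    (hf0 : f 0 = - s * e 1) (hf1 : f 1 = s * e 0) (x y : ℝ) (hx : x ∈ Icc (-ℓ) ℓ)
    (hy : y ∈ Icc 0 (δ / 2)) : x₀ + x • e + y • f ∈ ball x₀ δ := by
  have hn : e 0 ^ 2 + e 1 ^ 2 = 1 := by
    have := EuclideanSpace.real_norm_sq_eq e
    rw [he, Fin.sum_univ_two] at this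
    linarith
  rw [mem_ball_iff_norm, show x₀ + x • e + y • f - x₀ = x • e + y • f by abel]
  have h : ‖x • e + y • f‖ ^ 2 = x ^ 2 + y ^ 2 := by
    rw [EuclideanSpace.real_norm_sq_eq, Fin.sum_univ_two]
    simp only [PiLp.add_apply, PiLp.smul_apply, smul_eq_mul, hf0, hf1]
    linear_combination (x ^ 2 + s ^ 2 * y ^ 2) * hn + y ^ 2 * hs
  obtain ⟨h1, h2⟩ := hx
  obtain ⟨h3, h4⟩ := hy
  have h5 : x ^ 2 ≤ (δ / 2) ^ 2 := sq_le_sq' (by linarith) (by linarith)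
  have h6 : y ^ 2 ≤ (δ / 2) ^ 2 := sq_le_sq' (by linarith) (by linarith)
  apply lt_of_pow_lt_pow_left₀ 2 hδ.le
  rw [h]
  nlinarith

lemma half_geo (Ω : Set (E 2)) (hΩ : IsOpen Ω) (ψ : E 2 → ℝ)
    (hC2 : ContDiffOn ℝ 2 ψ Ω) (hconv : ConvexOn ℝ Ω ψ)
    (hnonneg : ∀ x ∈ Ω, 0 ≤ ψ x)
    (lam : ℝ) (hlam : 0 < lam)
    (hdet : ∀ x ∈ Ω, 1 / lam ^ 2 ≤ hessDet ψ x)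
    (x₀ : E 2) (δ : ℝ) (hδ : 0 < δ) (hball : ball x₀ δ ⊆ Ω)
    (L : ℝ) (hL : 0 < L) (hLb : ∀ x ∈ Ω, ‖fderiv ℝ ψ x‖ ≤ L)
    (e f : E 2) (he : ‖e‖ = 1) (s : ℝ) (hs : s ^ 2 = 1)
    (hf0 : f 0 = - s * e 1) (hf1 : f 1 = s * e 0)
    (ℓ : ℝ) (hℓ0 : 0 < ℓ) (hℓ : ℓ ≤ δ / 2) (γ : ℝ) (hγ : 0 < γ)
    (hM : ∀ t ∈ Icc (-ℓ) ℓ, ψ (x₀ + t • e) ≤ L * γ) :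
    ℓ ^ 3 / (4 * lam ^ 2 * L) * Real.log (1 + (δ / 2) / γ) ≤
      ∫ x in (-(ℓ/2))..(ℓ/2), (fderiv ℝ ψ (x₀ + x • e + (δ / 2) • f) f
        - fderiv ℝ ψ (x₀ + x • e) f) := by
  have hmem : ∀ x ∈ Icc (-ℓ) ℓ, ∀ y ∈ Icc 0 (δ / 2), x₀ + x • e + y • f ∈ Ω :=
    fun x hx y hy => hball (mem_rect x₀ e f δ ℓ hδ hℓ he s hs hf0 hf1 x y hx hy)
  have hcm : ∀ x y : ℝ, x₀ + x • e + y • f = x₀ + y • f + x • e := fun x y => by abel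
  have hfn : ‖f‖ = 1 := by
    have h1 := EuclideanSpace.real_norm_sq_eq f
    have h2 := EuclideanSpace.real_norm_sq_eq e
    rw [Fin.sum_univ_two] at h1 h2
    rw [he] at h2
    rw [hf0, hf1] at h1
    have : ‖f‖ ^ 2 = 1 := by
      rw [h1]; linear_combination (e 0 ^ 2 + e 1 ^ 2) * hs - h2
    nlinarith [norm_nonneg f]
  have hcont : ContinuousOn (fun z : ℝ × ℝ => x₀ + z.1 • e + z.2 • f)
      (Icc (-ℓ) ℓ ×ˢ Icc 0 (δ / 2)) := by fun_prop
  have key := half_core (fun x y => ψ (x₀ + x • e + y • f))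
    (fun x y => fderiv ℝ ψ (x₀ + x • e + y • f) e)
    (fun x y => fderiv ℝ ψ (x₀ + x • e + y • f) f)
    (fun x y => fderiv ℝ (fderiv ℝ ψ) (x₀ + x • e + y • f) e e)
    (fun x y => fderiv ℝ (fderiv ℝ ψ) (x₀ + x • e + y • f) f f)
    ℓ (δ / 2) γ L lam hℓ0 (by linarith) hγ hL hlam ?_ ?_ ?_ ?_ ?_ ?_ ?_ ?_ ?_
  · simpa using key
  · intro x hx y hy
    have := hmem x hx y hy
    simp only [hcm] at this ⊢
    exact hasDerivAt_line Ω hΩ ψ hC2 _ e x this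
  · intro x hx y hy
    have := hmem x hx y hy
    simp only [hcm] at this ⊢
    exact hasDerivAt_line2 Ω hΩ ψ hC2 _ e e x this
  · intro x hx y hy
    exact hasDerivAt_line2 Ω hΩ ψ hC2 _ f f y (hmem x hx y hy)
  · exact (hess_cont Ω hΩ ψ hC2 e e).comp hcont (fun z hz => hmem _ hz.1 _ hz.2)
  · exact (hess_cont Ω hΩ ψ hC2 f f).comp hcont (fun z hz => hmem _ hz.1 _ hz.2)
  · intro x hx y hy
    exact hess_pos Ω hΩ ψ hC2 hconv lam hlam hdet e he _ (hmem x hx y hy)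
  · intro x hx y hy
    exact (hdet _ (hmem x hx y hy)).trans
      (hess_prod Ω hΩ ψ hC2 e f he s hs hf0 hf1 _ (hmem x hx y hy))
  · intro x hx y hy
    exact hnonneg _ (hmem x hx y hy)
  · intro x hx y hy
    have h0 : x₀ + x • e ∈ Ω := by simpa using hmem x hx 0 ⟨le_rfl, by linarith⟩
    have h1 := hconv.1.norm_image_sub_le_of_norm_fderiv_le (𝕜 := ℝ) (f := ψ) (C := L)
      (fun z hz => (hC2.contDiffAt (hΩ.mem_nhds hz)).differentiableAt (by norm_num)) hLb
      h0 (hmem x hx y hy)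
    rw [add_sub_cancel_left, norm_smul, hfn, Real.norm_eq_abs, Real.norm_eq_abs,
      abs_of_nonneg hy.1] at h1
    have h2 := (abs_le.1 h1).2
    have h3 := hM x hx
    show ψ (x₀ + x • e + y • f) ≤ _
    linarith

/-- the two-dimensional strict convexity estimate of Aleksandrov–Heinz:
`ℓ² ln(1 + δ/γ) ≤ 8 λ² L²`. -/
theorem stmt9 (Ω : Set (E 2)) (hΩ : IsOpen Ω) (ψ : E 2 → ℝ)
    (hC2 : ContDiffOn ℝ 2 ψ Ω) (hconv : ConvexOn ℝ Ω ψ)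
    (hnonneg : ∀ x ∈ Ω, 0 ≤ ψ x)
    (lam : ℝ) (hlam : 0 < lam)
    (hdet : ∀ x ∈ Ω, 1 / lam ^ 2 ≤ hessDet ψ x)
    (x₀ : E 2) (hx₀ : x₀ ∈ Ω) (hψx₀ : ψ x₀ = 0)
    (δ : ℝ) (hδdef : δ = infDist x₀ (frontier Ω)) (hδ : 0 < δ)
    (L : ℝ) (hLdef : L = sSup ((fun x => ‖gradient ψ x‖) '' Ω))
    (hLbdd : BddAbove ((fun x => ‖gradient ψ x‖) '' Ω)) (hL : 0 < L)
    (e : E 2) (he : ‖e‖ = 1)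
    (ℓ : ℝ) (hℓ0 : 0 < ℓ) (hℓ : ℓ ≤ δ / 2)
    (γ : ℝ) (hγdef : γ =
      sSup (ψ '' (closedBall x₀ ℓ ∩ {p : E 2 | ∃ t : ℝ, p = x₀ + t • e})) / L) :
    0 < γ ∧ ℓ ^ 2 * Real.log (1 + δ / γ) ≤ 8 * lam ^ 2 * L ^ 2 := by
  -- the ball of radius δ lies in Ω
  have hball : ball x₀ δ ⊆ Ω := by
    have hdis : Disjoint (ball x₀ δ) (frontier Ω) := hδdef ▸ disjoint_ball_infDist
    have hpre : IsPreconnected (ball x₀ δ) := (convex_ball x₀ δ).isPreconnected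
    rcases hpre.subset_or_subset hΩ isClosed_closure.isOpen_compl
      (disjoint_compl_right.mono_left subset_closure) (fun z hz => by
        by_contra hcon
        rw [mem_union, not_or, mem_compl_iff, not_not] at hcon
        refine Set.disjoint_left.1 hdis hz ?_
        rw [hΩ.frontier_eq]
        exact ⟨hcon.2, hcon.1⟩) with h | h
    · exact h
    · exact absurd (subset_closure hx₀) (h (mem_ball_self hδ))
  have hLb : ∀ x ∈ Ω, ‖fderiv ℝ ψ x‖ ≤ L := by
    intro x hx
    rw [← toDual_gradient, LinearIsometryEquiv.norm_map, hLdef]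
    exact le_csSup hLbdd ⟨x, hx, rfl⟩
  set K : Set (E 2) := closedBall x₀ ℓ ∩ {p : E 2 | ∃ t : ℝ, p = x₀ + t • e} with hK
  have hKΩ : closedBall x₀ ℓ ⊆ Ω := (closedBall_subset_ball (by linarith)).trans hball
  have hbdd : BddAbove (ψ '' K) :=
    ((isCompact_closedBall x₀ ℓ).bddAbove_image (hC2.continuousOn.mono hKΩ)).mono
      (image_mono inter_subset_left)
  have hmemK : ∀ t ∈ Icc (-ℓ) ℓ, x₀ + t • e ∈ K := by
    intro t ht
    refine ⟨?_, t, rfl⟩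
    rw [mem_closedBall_iff_norm, add_sub_cancel_left, norm_smul, he, mul_one, Real.norm_eq_abs]
    exact abs_le.2 ht
  have hM : ∀ t ∈ Icc (-ℓ) ℓ, ψ (x₀ + t • e) ≤ L * γ := by
    intro t ht
    rw [hγdef, mul_div_cancel₀ _ hL.ne']
    exact le_csSup hbdd ⟨_, hmemK t ht, rfl⟩
  have hmemΩ : ∀ t ∈ Icc (-ℓ) ℓ, x₀ + t • e ∈ Ω := fun t ht => hKΩ (hmemK t ht).1
  have hγ : 0 < γ := by
    obtain ⟨h1, h2⟩ := slope_core (fun t => ψ (x₀ + t • e)) (fun t => fderiv ℝ ψ (x₀ + t • e) e)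
      (fun t => fderiv ℝ (fderiv ℝ ψ) (x₀ + t • e) e e) ℓ (L * γ) hℓ0
      (fun t ht => hasDerivAt_line Ω hΩ ψ hC2 x₀ e t (hmemΩ t ht))
      (fun t ht => hasDerivAt_line2 Ω hΩ ψ hC2 x₀ e e t (hmemΩ t ht))
      (fun t ht => hess_pos Ω hΩ ψ hC2 hconv lam hlam hdet e he _ (hmemΩ t ht))
      (fun t ht => hnonneg _ (hmemΩ t ht)) hM
    have h3 : 0 < 4 / ℓ * (L * γ) := h1.trans_le h2
    have h4 : 0 < L * γ := pos_of_mul_pos_right h3 (by positivity)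
    exact pos_of_mul_pos_right h4 hL.le
  refine ⟨hγ, ?_⟩
  set f : E 2 := !₂[- e 1, e 0] with hf
  have hP := half_geo Ω hΩ ψ hC2 hconv hnonneg lam hlam hdet x₀ δ hδ hball L hL hLb e f he 1
    (by norm_num) (by simp [hf]) (by simp [hf]) ℓ hℓ0 hℓ γ hγ hM
  have hN := half_geo Ω hΩ ψ hC2 hconv hnonneg lam hlam hdet x₀ δ hδ hball L hL hLb e (-f) he (-1)
    (by norm_num) (by simp [hf]) (by simp [hf]) ℓ hℓ0 hℓ γ hγ hM
  have hfn : ‖f‖ = 1 := by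
    have h1 := EuclideanSpace.real_norm_sq_eq f
    have h2 := EuclideanSpace.real_norm_sq_eq e
    rw [Fin.sum_univ_two] at h1 h2
    rw [he] at h2
    have : ‖f‖ ^ 2 = 1 := by
      rw [h1]; simp [hf]; linarith
    nlinarith [norm_nonneg f]
  have hle : -(ℓ/2) ≤ ℓ/2 := by linarith
  have hmP : ∀ x ∈ Icc (-(ℓ/2)) (ℓ/2), ∀ y ∈ Icc 0 (δ/2), x₀ + x • e + y • f ∈ Ω :=
    fun x hx y hy => hball (mem_rect x₀ e f δ ℓ hδ hℓ he 1 (by norm_num) (by simp [hf])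
      (by simp [hf]) x y ⟨by linarith [hx.1], by linarith [hx.2]⟩ hy)
  have hmN : ∀ x ∈ Icc (-(ℓ/2)) (ℓ/2), ∀ y ∈ Icc 0 (δ/2), x₀ + x • e + y • (-f) ∈ Ω :=
    fun x hx y hy => hball (mem_rect x₀ e (-f) δ ℓ hδ hℓ he (-1) (by norm_num) (by simp [hf])
      (by simp [hf]) x y ⟨by linarith [hx.1], by linarith [hx.2]⟩ hy)
  have hY : δ / 2 ∈ Icc 0 (δ / 2) := ⟨by linarith, le_rfl⟩
  have hY0 : (0:ℝ) ∈ Icc 0 (δ / 2) := ⟨le_rfl, by linarith⟩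
  have hdc : ContinuousOn (fderiv ℝ ψ) Ω := (contDiffOn_fderiv' Ω hΩ ψ hC2).continuousOn
  have hIntg : ∀ (g : ℝ → E 2) (w : E 2), Continuous g →
      (∀ x ∈ Icc (-(ℓ/2)) (ℓ/2), g x ∈ Ω) →
      IntervalIntegrable (fun x => fderiv ℝ ψ (g x) w) volume (-(ℓ/2)) (ℓ/2) := by
    intro g w hg hgm
    apply ContinuousOn.intervalIntegrable_of_Icc hle
    exact (hdc.comp hg.continuousOn hgm).clm_apply continuousOn_const
  have i1 := hIntg (fun x => x₀ + x • e + (δ/2) • f) f (by fun_prop) (fun x hx => hmP x hx _ hY)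
  have i0 : ∀ w, IntervalIntegrable (fun x : ℝ => fderiv ℝ ψ (x₀ + x • e) w) volume
      (-(ℓ/2)) (ℓ/2) := fun w => hIntg (fun x => x₀ + x • e) w (by fun_prop)
      (fun x hx => by simpa using hmP x hx _ hY0)
  have i2 := hIntg (fun x => x₀ + x • e + (δ/2) • (-f)) (-f) (by fun_prop)
    (fun x hx => hmN x hx _ hY)
  have hsum := add_le_add hP hN
  rw [← intervalIntegral.integral_add (i1.sub (i0 f)) (i2.sub (i0 (-f)))] at hsum
  have hup : ∫ x in (-(ℓ/2))..(ℓ/2), ((fderiv ℝ ψ (x₀ + x • e + (δ / 2) • f) f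
        - fderiv ℝ ψ (x₀ + x • e) f) + (fderiv ℝ ψ (x₀ + x • e + (δ / 2) • (-f)) (-f)
        - fderiv ℝ ψ (x₀ + x • e) (-f))) ≤ ∫ x in (-(ℓ/2))..(ℓ/2), 2 * L := by
    apply intervalIntegral.integral_mono_on hle
      ((i1.sub (i0 f)).add (i2.sub (i0 (-f)))) intervalIntegrable_const
    intro x hx
    have b1 := (fderiv ℝ ψ (x₀ + x • e + (δ / 2) • f)).le_opNorm f
    have b2 := (fderiv ℝ ψ (x₀ + x • e + (δ / 2) • (-f))).le_opNorm (-f)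
    rw [hfn, mul_one, Real.norm_eq_abs] at b1
    rw [norm_neg, hfn, mul_one, Real.norm_eq_abs] at b2
    have b3 := hLb _ (hmP x hx _ hY)
    have b4 := hLb _ (hmN x hx _ hY)
    have b5 : fderiv ℝ ψ (x₀ + x • e) (-f) = - fderiv ℝ ψ (x₀ + x • e) f := map_neg _ _
    linarith [le_abs_self (fderiv ℝ ψ (x₀ + x • e + (δ / 2) • f) f),
      le_abs_self (fderiv ℝ ψ (x₀ + x • e + (δ / 2) • (-f)) (-f))]
  rw [intervalIntegral.integral_const, smul_eq_mul] at hup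
  have hfin : ℓ ^ 3 / (4 * lam ^ 2 * L) * Real.log (1 + (δ / 2) / γ) ≤ L * ℓ := by
    have := hsum.trans hup
    nlinarith
  have hlog : Real.log (1 + δ / γ) ≤ 2 * Real.log (1 + (δ / 2) / γ) := by
    rw [show (2:ℝ) * Real.log (1 + (δ / 2) / γ) = Real.log ((1 + (δ / 2) / γ) ^ 2) by
      rw [Real.log_pow]; norm_num]
    apply Real.log_le_log (by positivity)
    have : (1 + (δ / 2) / γ) ^ 2 = 1 + δ / γ + ((δ / 2) / γ) ^ 2 := by ring
    rw [this]
    linarith [sq_nonneg ((δ / 2) / γ)]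
  have h1 : ℓ ^ 2 * Real.log (1 + (δ / 2) / γ) ≤ 4 * lam ^ 2 * L ^ 2 := by
    rw [div_mul_eq_mul_div, div_le_iff₀ (by positivity)] at hfin
    have : ℓ * (ℓ ^ 2 * Real.log (1 + (δ / 2) / γ)) ≤ ℓ * (4 * lam ^ 2 * L ^ 2) := by
      linarith
    exact le_of_mul_le_mul_left this hℓ0
  nlinarith [mul_le_mul_of_nonneg_left hlog (sq_nonneg ℓ)]
end
end
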